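/- Let α ∈ (1,2] and let γ be a probability measure on [1,∞) that is a fixed point of the α-recursive distributional equation. Then the first and second moments of γ are finite and satisfy ∫ s² γ(ds) = (α/(α−1)) · ∫ s γ(ds); moreover, if α ∈ (1,2), then the third moment is infinite: ∫ s³ γ(ds) = ∞. -/

import Mathlib

open MeasureTheory

/-- The α-offspring distribution: θ_α(k) = α(2−α)(3−α)⋯(k−1−α)/k! for k ≥ 2, and 0 else. -/
noncomputable def thetaDist (α : ℝ) (k : ℕ) : ℝ :=
  if 2 ≤ k then α * (∏ i ∈ Finset.Icc 2 (k - 1), ((i : ℝ) - α)) / (Nat.factorial k : ℝ) else 0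

/-- The uniform distribution on [0,1]. -/
noncomputable def unifMeasure : Measure ℝ := volume.restrict (Set.Icc 0 1)

/-- The map on measures associated with the α-recursive distributional equation:
the law of G(U,N,(X₁,…,X_N)) = (U + (1−U)/(X₁+⋯+X_N))⁻¹ where U is uniform on [0,1],
N ~ θ_α and the X_i are i.i.d. with law γ, all independent (decomposed according to
the value of N). -/
noncomputable def rdeMap (α : ℝ) (γ : Measure ℝ) : Measure ℝ :=
  Measure.sum fun k : ℕ =>
    ENNReal.ofReal (thetaDist α k) •
      Measure.map (fun p : ℝ × (Fin k → ℝ) => (p.1 + (1 - p.1) / ∑ i, p.2 i)⁻¹)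
        (unifMeasure.prod (Measure.pi fun _ : Fin k => γ))

/-- γ is a probability measure on [1,∞) that is a fixed point of the α-recursive
distributional equation. -/
def IsRDEFixedPoint (α : ℝ) (γ : Measure ℝ) : Prop :=
  IsProbabilityMeasure γ ∧ γ (Set.Iio 1) = 0 ∧ rdeMap α γ = γ

open Filter Topology

/-! ### The offspring distribution -/

lemma prod_Icc_sub_nonneg {α : ℝ} (hα : α ≤ 2) (m : ℕ) :
    0 ≤ ∏ i ∈ Finset.Icc 2 m, ((i : ℝ) - α) := by
  refine Finset.prod_nonneg fun i hi => ?_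
  have : (2 : ℝ) ≤ i := by exact_mod_cast (Finset.mem_Icc.1 hi).1
  linarith

lemma thetaDist_nonneg {α : ℝ} (hα : α ∈ Set.Ioc (1 : ℝ) 2) (k : ℕ) : 0 ≤ thetaDist α k := by
  unfold thetaDist
  split_ifs
  · have := prod_Icc_sub_nonneg hα.2 (k - 1)
    have := hα.1
    positivity
  · rfl

lemma thetaDist_eq_zero {α : ℝ} {k : ℕ} (hk : k < 2) : thetaDist α k = 0 := by
  simp [thetaDist, hk]

/-- The mean of the offspring distribution carried by the integers `≥ n + 2`. -/
noncomputable def thetaTail (α : ℝ) (n : ℕ) : ℝ :=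
  α / (α - 1) * (∏ i ∈ Finset.Icc 2 (n + 1), ((i : ℝ) - α)) / (Nat.factorial n : ℝ)

lemma thetaTail_nonneg {α : ℝ} (hα : α ∈ Set.Ioc (1 : ℝ) 2) (n : ℕ) : 0 ≤ thetaTail α n := by
  have h := prod_Icc_sub_nonneg hα.2 (n + 1)
  have h1 : 0 < α - 1 := by linarith [hα.1]
  have h2 : 0 < α := by linarith
  unfold thetaTail
  positivity

lemma thetaTail_zero (α : ℝ) : thetaTail α 0 = α / (α - 1) := by
  simp [thetaTail]

lemma thetaTail_succ (α : ℝ) (n : ℕ) :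
    thetaTail α (n + 1) * (n + 1) = thetaTail α n * (n + 2 - α) := by
  unfold thetaTail
  rw [Finset.prod_Icc_succ_top (by omega : 2 ≤ n + 1 + 1), Nat.factorial_succ]
  have : (Nat.factorial n : ℝ) ≠ 0 := by positivity
  push_cast
  field_simp
  ring

lemma mean_thetaDist_eq {α : ℝ} (hα : 1 < α) (n : ℕ) :
    ((n + 2 : ℕ) : ℝ) * thetaDist α (n + 2) * (n + 1) = (α - 1) * thetaTail α n := by
  have h1 : α - 1 ≠ 0 := by linarith
  have : (Nat.factorial n : ℝ) ≠ 0 := by positivity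
  simp only [thetaDist, thetaTail, Nat.le_add_left, if_true, Nat.factorial_succ]
  rw [show n + 2 - 1 = n + 1 by omega]
  push_cast
  field_simp
  ring

lemma mean_thetaDist_eq_sub {α : ℝ} (hα : 1 < α) (n : ℕ) :
    ((n + 2 : ℕ) : ℝ) * thetaDist α (n + 2) = thetaTail α n - thetaTail α (n + 1) := by
  have h1 := thetaTail_succ α n
  have h2 := mean_thetaDist_eq hα n
  have h3 : (n + 1 : ℝ) ≠ 0 := by positivity
  apply mul_right_cancel₀ h3
  linarith

lemma sum_mean_thetaDist {α : ℝ} (hα : 1 < α) (n : ℕ) :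
    ∑ j ∈ Finset.range n, ((j + 2 : ℕ) : ℝ) * thetaDist α (j + 2)
      = α / (α - 1) - thetaTail α n := by
  simp_rw [mean_thetaDist_eq_sub hα]
  rw [Finset.sum_range_sub', thetaTail_zero]

lemma not_summable_const_div_succ {c : ℝ} (hc : c ≠ 0) :
    ¬ Summable (fun n : ℕ => c / ((n : ℝ) + 1)) := by
  intro h
  have h2 : Summable (fun n : ℕ => (1 : ℝ) / ((n + 1 : ℕ) : ℝ)) := by
    refine (h.mul_left c⁻¹).congr fun n => ?_
    push_cast
    field_simp
  exact Real.not_summable_one_div_natCast ((summable_nat_add_iff 1).1 h2)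

lemma summable_mean_thetaDist_shift {α : ℝ} (hα : α ∈ Set.Ioc (1 : ℝ) 2) :
    Summable (fun n : ℕ => ((n + 2 : ℕ) : ℝ) * thetaDist α (n + 2)) := by
  refine summable_of_sum_range_le (c := α / (α - 1))
    (fun n => mul_nonneg (Nat.cast_nonneg _) (thetaDist_nonneg hα _)) fun n => ?_
  rw [sum_mean_thetaDist hα.1]
  linarith [thetaTail_nonneg hα n]

lemma thetaTail_antitone {α : ℝ} (hα : α ∈ Set.Ioc (1 : ℝ) 2) : Antitone (thetaTail α) := by
  refine antitone_nat_of_succ_le fun n => ?_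
  have := mean_thetaDist_eq_sub hα.1 n
  have h : 0 ≤ ((n + 2 : ℕ) : ℝ) * thetaDist α (n + 2) :=
    mul_nonneg (Nat.cast_nonneg _) (thetaDist_nonneg hα _)
  linarith

lemma tendsto_thetaTail {α : ℝ} (hα : α ∈ Set.Ioc (1 : ℝ) 2) :
    Tendsto (thetaTail α) atTop (𝓝 0) := by
  have hbdd : BddBelow (Set.range (thetaTail α)) :=
    ⟨0, by rintro _ ⟨n, rfl⟩; exact thetaTail_nonneg hα n⟩
  have hlim := tendsto_atTop_ciInf (thetaTail_antitone hα) hbdd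
  have hle : ∀ n, ⨅ i, thetaTail α i ≤ thetaTail α n := fun n => ciInf_le hbdd n
  have hL : 0 ≤ ⨅ i, thetaTail α i := le_ciInf (thetaTail_nonneg hα)
  generalize (⨅ i, thetaTail α i) = L at *
  rcases hL.eq_or_lt with h0 | hpos
  · rwa [← h0] at hlim
  exfalso
  have h1 : 0 < α - 1 := by linarith [hα.1]
  have hc : (α - 1) * L ≠ 0 := by positivity
  refine not_summable_const_div_succ hc
    (Summable.of_nonneg_of_le (fun n => by positivity) (fun n => ?_)
      (summable_mean_thetaDist_shift hα))
  rw [div_le_iff₀ (by positivity), mean_thetaDist_eq hα.1]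
  exact mul_le_mul_of_nonneg_left (hle n) h1.le

lemma hasSum_mean_thetaDist {α : ℝ} (hα : α ∈ Set.Ioc (1 : ℝ) 2) :
    HasSum (fun k : ℕ => (k : ℝ) * thetaDist α k) (α / (α - 1)) := by
  have h : HasSum (fun n : ℕ => ((n + 2 : ℕ) : ℝ) * thetaDist α (n + 2)) (α / (α - 1)) := by
    rw [(summable_mean_thetaDist_shift hα).hasSum_iff_tendsto_nat]
    simp_rw [sum_mean_thetaDist hα.1]
    simpa using (tendsto_thetaTail hα).const_sub (α / (α - 1))
  have h2 := (hasSum_nat_add_iff (f := fun k : ℕ => (k : ℝ) * thetaDist α k) 2).1 h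
  simpa [Finset.sum_range_succ, thetaDist_eq_zero] using h2

lemma not_summable_sq_mul_thetaDist {α : ℝ} (hα : α ∈ Set.Ioo (1 : ℝ) 2) :
    ¬ Summable (fun k : ℕ => (k : ℝ) ^ 2 * thetaDist α k) := by
  have hα' : α ∈ Set.Ioc (1 : ℝ) 2 := ⟨hα.1, hα.2.le⟩
  have h1 : 0 < α - 1 := by linarith [hα.1]
  have h2 : 0 < 2 - α := by linarith [hα.2]
  have hα0 : 0 < α := by linarith
  have hc : 0 < thetaTail α 1 := by
    have := thetaTail_succ α 0
    rw [thetaTail_zero] at this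
    simp at this
    rw [this]
    positivity
  have hlow : ∀ n : ℕ, thetaTail α 1 ≤ thetaTail α (n + 1) * (n + 1) := by
    intro n
    induction n with
    | zero => simp
    | succ n ih =>
      have hs := thetaTail_succ α (n + 1)
      have hn := thetaTail_nonneg hα' (n + 1)
      push_cast at hs ⊢
      nlinarith
  intro hsum
  have hsum3 := (summable_nat_add_iff 3).2 hsum
  refine not_summable_const_div_succ (c := (α - 1) * thetaTail α 1) (by positivity)
    (Summable.of_nonneg_of_le (fun n => by positivity) (fun n => ?_) hsum3)
  rw [div_le_iff₀ (by positivity)]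
  have hm := mean_thetaDist_eq hα.1 (n + 1)
  have hθ := thetaDist_nonneg hα' (n + 3)
  have hl := mul_le_mul_of_nonneg_left (hlow n) h1.le
  rw [← mul_assoc, ← hm] at hl
  refine hl.trans ?_
  rw [show n + 1 + 2 = n + 3 by omega]
  have hn : (0 : ℝ) ≤ n := Nat.cast_nonneg n
  push_cast
  have h5 : 0 ≤ ((n : ℝ) + 3) * thetaDist α (n + 3) * (n + 1) := by positivity
  nlinarith

lemma tsum_mean_thetaDist {α : ℝ} (hα : α ∈ Set.Ioc (1 : ℝ) 2) :
    ∑' k : ℕ, ENNReal.ofReal (thetaDist α k) * (k : ENNReal) = ENNReal.ofReal (α / (α - 1)) := by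
  have h := hasSum_mean_thetaDist hα
  rw [← h.tsum_eq, ENNReal.ofReal_tsum_of_nonneg
    (fun k => mul_nonneg (Nat.cast_nonneg _) (thetaDist_nonneg hα _)) h.summable]
  refine tsum_congr fun k => ?_
  rw [ENNReal.ofReal_mul (Nat.cast_nonneg _), ENNReal.ofReal_natCast, mul_comm]

lemma tsum_sq_thetaDist {α : ℝ} (hα : α ∈ Set.Ioo (1 : ℝ) 2) :
    ∑' k : ℕ, ENNReal.ofReal (thetaDist α k) * ENNReal.ofReal ((k : ℝ) ^ 2) = ⊤ := by
  by_contra h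
  refine not_summable_sq_mul_thetaDist hα ((ENNReal.summable_toReal h).congr fun k => ?_)
  rw [ENNReal.toReal_mul, ENNReal.toReal_ofReal (thetaDist_nonneg ⟨hα.1, hα.2.le⟩ k),
    ENNReal.toReal_ofReal (by positivity), mul_comm]

/-! ### Integrals against the uniform law -/

instance : IsProbabilityMeasure unifMeasure := ⟨by simp [unifMeasure]⟩

lemma ae_unifMeasure_mem : ∀ᵐ u ∂unifMeasure, u ∈ Set.Ioc (0 : ℝ) 1 := by
  rw [unifMeasure, ← restrict_Ioc_eq_restrict_Icc]
  exact ae_restrict_mem measurableSet_Ioc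

lemma lintegral_sqrt_inv_unifMeasure_lt_top :
    ∫⁻ u, ENNReal.ofReal (√(u⁻¹)) ∂unifMeasure < ⊤ := by
  have h := intervalIntegral.intervalIntegrable_rpow' (a := 0) (b := 1)
    (by norm_num : (-1 : ℝ) < -(1 / 2))
  rw [intervalIntegrable_iff_integrableOn_Ioc_of_le zero_le_one] at h
  refine lt_of_eq_of_lt ?_ h.lintegral_lt_top
  rw [unifMeasure, ← restrict_Ioc_eq_restrict_Icc]
  refine setLIntegral_congr_fun measurableSet_Ioc fun u hu => ?_
  rw [Real.rpow_neg hu.1.le, ← Real.sqrt_eq_rpow, Real.sqrt_inv]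

lemma le_convex_inv {u s : ℝ} (hu : u ∈ Set.Icc (0 : ℝ) 1) (hs : 1 ≤ s) :
    s⁻¹ ≤ u + (1 - u) / s := by
  have h0 : 0 < s := by linarith
  have h : u + (1 - u) / s - s⁻¹ = u * (s - 1) / s := by field_simp; ring
  have : 0 ≤ u * (s - 1) / s := div_nonneg (mul_nonneg hu.1 (by linarith)) h0.le
  linarith

lemma self_le_convex_inv {u s : ℝ} (hu : u ∈ Set.Icc (0 : ℝ) 1) (hs : 1 ≤ s) :
    u ≤ u + (1 - u) / s := by
  have : 0 ≤ (1 - u) / s := div_nonneg (by linarith [hu.2]) (by linarith)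
  linarith

lemma lintegral_sqrt_unifMeasure_le {s : ℝ} (hs : 1 ≤ s) :
    ∫⁻ u, ENNReal.ofReal √((u + (1 - u) / s)⁻¹) ∂unifMeasure
      ≤ ∫⁻ u, ENNReal.ofReal (√(u⁻¹)) ∂unifMeasure := by
  refine lintegral_mono_ae ?_
  filter_upwards [ae_unifMeasure_mem] with u hu
  have hu' := Set.Ioc_subset_Icc_self hu
  exact ENNReal.ofReal_le_ofReal (Real.sqrt_le_sqrt
    (inv_anti₀ hu.1 (self_le_convex_inv hu' hs)))

lemma lintegral_unifMeasure_le {s : ℝ} (hs : 1 ≤ s) :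
    ∫⁻ u, ENNReal.ofReal (u + (1 - u) / s)⁻¹ ∂unifMeasure
      ≤ (∫⁻ u, ENNReal.ofReal (√(u⁻¹)) ∂unifMeasure) * ENNReal.ofReal √s := by
  rw [← lintegral_mul_const _ (by fun_prop)]
  refine lintegral_mono_ae ?_
  filter_upwards [ae_unifMeasure_mem] with u hu
  have hu' := Set.Ioc_subset_Icc_self hu
  have h0 : 0 < s := by linarith
  rw [← ENNReal.ofReal_mul (Real.sqrt_nonneg _)]
  refine ENNReal.ofReal_le_ofReal ?_
  have h1 := inv_anti₀ hu.1 (self_le_convex_inv hu' hs)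
  have h2 := inv_anti₀ (inv_pos.2 h0) (le_convex_inv hu' hs)
  rw [inv_inv] at h2
  have h3 : 0 ≤ (u + (1 - u) / s)⁻¹ :=
    inv_nonneg.2 (hu.1.le.trans (self_le_convex_inv hu' hs))
  calc (u + (1 - u) / s)⁻¹ = √((u + (1 - u) / s)⁻¹) * √((u + (1 - u) / s)⁻¹) :=
        (Real.mul_self_sqrt h3).symm
    _ ≤ √(u⁻¹) * √s :=
        mul_le_mul (Real.sqrt_le_sqrt h1) (Real.sqrt_le_sqrt h2) (Real.sqrt_nonneg _)
          (Real.sqrt_nonneg _)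

lemma lintegral_sq_unifMeasure {s : ℝ} (hs : 1 ≤ s) :
    ∫⁻ u, ENNReal.ofReal ((u + (1 - u) / s)⁻¹ ^ 2) ∂unifMeasure = ENNReal.ofReal s := by
  have h0 : 0 < s := by linarith
  have hpos : ∀ u ∈ Set.Icc (0 : ℝ) 1, 0 < u + (1 - u) / s := fun u hu =>
    (inv_pos.2 h0).trans_le (le_convex_inv hu hs)
  have hcont : ContinuousOn (fun u : ℝ => (u + (1 - u) / s)⁻¹ ^ 2) (Set.Icc 0 1) :=
    ((by fun_prop : ContinuousOn (fun u : ℝ => u + (1 - u) / s) _).inv₀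
      fun u hu => (hpos u hu).ne').pow 2
  have hFTC : ∫ u in (0 : ℝ)..1, (u + (1 - u) / s)⁻¹ ^ 2 = s := by
    rw [intervalIntegral.integral_eq_sub_of_hasDerivAt
      (f := fun u => s * u / (u + (1 - u) / s))]
    · simp
    · intro u hu
      rw [Set.uIcc_of_le zero_le_one] at hu
      have hp := hpos u hu
      have h := ((hasDerivAt_id u).const_mul s).div
        ((hasDerivAt_id u).add (((hasDerivAt_id u).const_sub 1).div_const s)) hp.ne'
      refine h.congr_deriv ?_
      simp only [id, Pi.add_apply]
      rw [inv_pow, div_eq_iff (by positivity), inv_mul_cancel₀ (by positivity)]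
      field_simp
      ring
    · exact ContinuousOn.intervalIntegrable (by rwa [Set.uIcc_of_le zero_le_one])
  rw [unifMeasure, ← ofReal_integral_eq_lintegral_ofReal
    hcont.integrableOn_Icc (ae_of_all _ fun u => sq_nonneg _),
    integral_Icc_eq_integral_Ioc, ← intervalIntegral.integral_of_le zero_le_one, hFTC]

lemma le_lintegral_cube_unifMeasure {s : ℝ} (hs : 1 ≤ s) :
    ENNReal.ofReal (1 / 8) * ENNReal.ofReal (s ^ 2)
      ≤ ∫⁻ u, ENNReal.ofReal ((u + (1 - u) / s)⁻¹ ^ 3) ∂unifMeasure := by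
  have h0 : 0 < s := by linarith
  have hsub : Set.Icc 0 s⁻¹ ⊆ Set.Icc (0 : ℝ) 1 :=
    Set.Icc_subset_Icc_right (inv_le_one_of_one_le₀ hs)
  calc ENNReal.ofReal (1 / 8) * ENNReal.ofReal (s ^ 2)
      = ∫⁻ _ in Set.Icc 0 s⁻¹, ENNReal.ofReal (s ^ 3 / 8) := by
        rw [setLIntegral_const, Real.volume_Icc, ← ENNReal.ofReal_mul (by norm_num),
          ← ENNReal.ofReal_mul (by positivity)]
        congr 1
        field_simp
        ring
    _ ≤ ∫⁻ u in Set.Icc 0 s⁻¹, ENNReal.ofReal ((u + (1 - u) / s)⁻¹ ^ 3) := by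
        refine setLIntegral_mono' measurableSet_Icc fun u hu => ENNReal.ofReal_le_ofReal ?_
        have hp := (inv_pos.2 h0).trans_le (le_convex_inv (hsub hu) hs)
        have hv : u + (1 - u) / s ≤ (s / 2)⁻¹ := by
          have h1 : (1 - u) / s ≤ s⁻¹ := by
            rw [div_eq_mul_inv]
            exact mul_le_of_le_one_left (inv_pos.2 h0).le (by linarith [hu.1])
          have h2 : (s / 2)⁻¹ = s⁻¹ + s⁻¹ := by field_simp; norm_num
          linarith [hu.2]
        have h3 : s / 2 ≤ (u + (1 - u) / s)⁻¹ := by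
          rw [← inv_inv (s / 2)]
          exact inv_anti₀ hp hv
        calc s ^ 3 / 8 = (s / 2) ^ 3 := by ring
          _ ≤ _ := pow_le_pow_left₀ (by positivity) h3 3
    _ ≤ _ := lintegral_mono_set hsub

/-! ### Integrals against a fixed point -/

lemma lintegral_eq_of_isRDEFixedPoint {α : ℝ} {γ : Measure ℝ} (hγ : IsRDEFixedPoint α γ)
    {f : ℝ → ENNReal} (hf : Measurable f) :
    ∫⁻ s, f s ∂γ = ∑' k : ℕ, ENNReal.ofReal (thetaDist α k) *
      ∫⁻ x : Fin k → ℝ, ∫⁻ u, f (u + (1 - u) / ∑ i, x i)⁻¹ ∂unifMeasure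
        ∂Measure.pi fun _ : Fin k => γ := by
  have := hγ.1
  conv_lhs => rw [← hγ.2.2]
  rw [rdeMap, lintegral_sum_measure]
  refine tsum_congr fun k => ?_
  have hG : Measurable fun p : ℝ × (Fin k → ℝ) => (p.1 + (1 - p.1) / ∑ i, p.2 i)⁻¹ := by
    fun_prop
  rw [lintegral_smul_measure, lintegral_map hf hG,
    lintegral_prod_symm _ (by fun_prop), smul_eq_mul]

lemma ae_pi_one_le {γ : Measure ℝ} [IsProbabilityMeasure γ] (hγ : ∀ᵐ s ∂γ, 1 ≤ s) (k : ℕ) :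
    ∀ᵐ x ∂Measure.pi fun _ : Fin k => γ, ∀ i, 1 ≤ x i :=
  ae_all_iff.2 fun i => (measurePreserving_eval (fun _ : Fin k => γ) i).quasiMeasurePreserving.ae hγ

lemma natCast_le_sum {k : ℕ} {x : Fin k → ℝ} (hx : ∀ i, 1 ≤ x i) : (k : ℝ) ≤ ∑ i, x i := by
  simpa using Finset.card_nsmul_le_sum Finset.univ x 1 fun i _ => hx i

lemma lintegral_pi_sum {γ : Measure ℝ} [IsProbabilityMeasure γ] {f : ℝ → ENNReal}
    (hf : Measurable f) (k : ℕ) :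
    ∫⁻ x, ∑ i, f (x i) ∂Measure.pi (fun _ : Fin k => γ) = k * ∫⁻ s, f s ∂γ := by
  rw [lintegral_finsetSum _ fun i _ => by fun_prop]
  simp [fun i => (measurePreserving_eval (fun _ : Fin k => γ) i).lintegral_comp hf]

lemma sqrt_sum_le {k : ℕ} {x : Fin k → ℝ} (hx : ∀ i, 0 ≤ x i) :
    √(∑ i, x i) ≤ ∑ i, √(x i) := by
  refine Finset.le_sum_of_subadditive_on_pred Real.sqrt (fun y => 0 ≤ y) Real.sqrt_zero.le ?_
    (fun _ _ => add_nonneg) x fun i _ => hx i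
  intro a b ha hb
  refine Real.sqrt_le_iff.2 ⟨by positivity, ?_⟩
  nlinarith [Real.sq_sqrt ha, Real.sq_sqrt hb, Real.sqrt_nonneg a, Real.sqrt_nonneg b,
    mul_nonneg (Real.sqrt_nonneg a) (Real.sqrt_nonneg b)]

/-- Comparison of the summands of two series weighted by the offspring distribution: only the
integers `k ≥ 2` and the vectors with entries `≥ 1` matter. -/
lemma thetaDist_mul_lintegral_mono {α : ℝ} {γ : Measure ℝ} [IsProbabilityMeasure γ]
    (hγ : ∀ᵐ s ∂γ, 1 ≤ s) {k : ℕ} {f g : (Fin k → ℝ) → ENNReal}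
    (h : ∀ x : Fin k → ℝ, (∀ i, 1 ≤ x i) → 1 ≤ ∑ i, x i → f x ≤ g x) :
    ENNReal.ofReal (thetaDist α k) * ∫⁻ x, f x ∂Measure.pi (fun _ : Fin k => γ)
      ≤ ENNReal.ofReal (thetaDist α k) * ∫⁻ x, g x ∂Measure.pi (fun _ : Fin k => γ) := by
  rcases lt_or_ge k 2 with hk | hk
  · simp [thetaDist_eq_zero hk]
  · gcongr 1
    refine lintegral_mono_ae ?_
    filter_upwards [ae_pi_one_le hγ k] with x hx
    have : (2 : ℝ) ≤ k := by exact_mod_cast hk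
    exact h x hx (by linarith [natCast_le_sum hx])

section FixedPoint

variable {α : ℝ} {γ : Measure ℝ}

lemma IsRDEFixedPoint.ae_one_le (hγ : IsRDEFixedPoint α γ) : ∀ᵐ s ∂γ, 1 ≤ s := by
  rw [ae_iff]
  simpa [Set.Iio] using hγ.2.1

lemma IsRDEFixedPoint.lintegral_sqrt_lt_top (hα : α ∈ Set.Ioc (1 : ℝ) 2)
    (hγ : IsRDEFixedPoint α γ) : ∫⁻ s, ENNReal.ofReal √s ∂γ < ⊤ := by
  have := hγ.1
  refine lt_of_le_of_lt (b := (∑' k : ℕ, ENNReal.ofReal (thetaDist α k)) *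
    ∫⁻ u, ENNReal.ofReal (√(u⁻¹)) ∂unifMeasure) ?_ ?_
  · rw [lintegral_eq_of_isRDEFixedPoint hγ (by fun_prop), ← ENNReal.tsum_mul_right]
    refine ENNReal.tsum_le_tsum fun k => ?_
    refine (thetaDist_mul_lintegral_mono hγ.ae_one_le
      fun x _ hs => lintegral_sqrt_unifMeasure_le hs).trans_eq ?_
    simp
  · refine ENNReal.mul_lt_top ?_ lintegral_sqrt_inv_unifMeasure_lt_top
    refine lt_of_le_of_lt (ENNReal.tsum_le_tsum fun k => ?_)
      ((tsum_mean_thetaDist hα).trans_lt ENNReal.ofReal_lt_top)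
    rcases lt_or_ge k 2 with hk | hk
    · simp [thetaDist_eq_zero hk]
    · exact le_mul_of_one_le_right' (by exact_mod_cast (by omega : 1 ≤ k))

lemma IsRDEFixedPoint.lintegral_lt_top (hα : α ∈ Set.Ioc (1 : ℝ) 2)
    (hγ : IsRDEFixedPoint α γ) : ∫⁻ s, ENNReal.ofReal s ∂γ < ⊤ := by
  have := hγ.1
  set K := ∫⁻ u, ENNReal.ofReal (√(u⁻¹)) ∂unifMeasure
  refine lt_of_le_of_lt (b := ENNReal.ofReal (α / (α - 1)) *
    (K * ∫⁻ s, ENNReal.ofReal √s ∂γ)) ?_ ?_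
  · rw [lintegral_eq_of_isRDEFixedPoint hγ (by fun_prop), ← tsum_mean_thetaDist hα,
      ← ENNReal.tsum_mul_right]
    refine ENNReal.tsum_le_tsum fun k => ?_
    refine (thetaDist_mul_lintegral_mono hγ.ae_one_le (g := fun x =>
      K * ∑ i, ENNReal.ofReal √(x i)) fun x hx hs => ?_).trans_eq ?_
    · refine (lintegral_unifMeasure_le hs).trans ?_
      gcongr
      rw [← ENNReal.ofReal_sum_of_nonneg fun i _ => Real.sqrt_nonneg _]
      exact ENNReal.ofReal_le_ofReal (sqrt_sum_le fun i => zero_le_one.trans (hx i))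
    · rw [lintegral_const_mul _ (by fun_prop),
        lintegral_pi_sum (f := fun s => ENNReal.ofReal √s) (by fun_prop)]
      ring
  · exact ENNReal.mul_lt_top ENNReal.ofReal_lt_top
      (ENNReal.mul_lt_top lintegral_sqrt_inv_unifMeasure_lt_top (hγ.lintegral_sqrt_lt_top hα))

lemma IsRDEFixedPoint.lintegral_sq (hα : α ∈ Set.Ioc (1 : ℝ) 2) (hγ : IsRDEFixedPoint α γ) :
    ∫⁻ s, ENNReal.ofReal (s ^ 2) ∂γ
      = ENNReal.ofReal (α / (α - 1)) * ∫⁻ s, ENNReal.ofReal s ∂γ := by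
  have := hγ.1
  rw [lintegral_eq_of_isRDEFixedPoint hγ (f := fun s => ENNReal.ofReal (s ^ 2)) (by fun_prop),
    ← tsum_mean_thetaDist hα, ← ENNReal.tsum_mul_right]
  refine tsum_congr fun k => ?_
  have key : ∀ x : Fin k → ℝ, (∀ i, 1 ≤ x i) → 1 ≤ ∑ i, x i →
      ∫⁻ u, ENNReal.ofReal ((u + (1 - u) / ∑ i, x i)⁻¹ ^ 2) ∂unifMeasure
        = ∑ i, ENNReal.ofReal (x i) := fun x hx hs => by
    rw [lintegral_sq_unifMeasure hs,
      ENNReal.ofReal_sum_of_nonneg fun i _ => zero_le_one.trans (hx i)]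
  rw [mul_assoc, ← lintegral_pi_sum (by fun_prop)]
  exact le_antisymm
    (thetaDist_mul_lintegral_mono hγ.ae_one_le fun x hx hs => (key x hx hs).le)
    (thetaDist_mul_lintegral_mono hγ.ae_one_le fun x hx hs => (key x hx hs).ge)

lemma IsRDEFixedPoint.lintegral_cube_eq_top (hα : α ∈ Set.Ioo (1 : ℝ) 2)
    (hγ : IsRDEFixedPoint α γ) : ∫⁻ s, ENNReal.ofReal (s ^ 3) ∂γ = ⊤ := by
  have := hγ.1
  have h8 : ENNReal.ofReal (1 / 8) ≠ 0 := by simp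
  rw [← top_le_iff, ← ENNReal.mul_top h8, ← tsum_sq_thetaDist hα, ← ENNReal.tsum_mul_left,
    lintegral_eq_of_isRDEFixedPoint hγ (f := fun s => ENNReal.ofReal (s ^ 3)) (by fun_prop)]
  refine ENNReal.tsum_le_tsum fun k => ?_
  refine le_of_eq_of_le ?_ (thetaDist_mul_lintegral_mono hγ.ae_one_le
    (f := fun _ => ENNReal.ofReal (1 / 8) * ENNReal.ofReal ((k : ℝ) ^ 2)) fun x hx hs =>
      le_trans ?_ (le_lintegral_cube_unifMeasure hs))
  · rw [lintegral_const, measure_univ, mul_one]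
    ring
  · gcongr
    exact natCast_le_sum hx

end FixedPoint

/-- For a fixed point γ of the α-RDE, the first and second moments are finite and
satisfy ∫ s² γ(ds) = (α/(α−1)) ∫ s γ(ds); if moreover α < 2, the third moment
is infinite. -/
theorem moments_of_fixed_point (α : ℝ) (hα : α ∈ Set.Ioc (1 : ℝ) 2)
    (γ : Measure ℝ) (hγ : IsRDEFixedPoint α γ) :
    Integrable (fun s : ℝ => s) γ ∧ Integrable (fun s : ℝ => s ^ 2) γ ∧
    (∫ s, s ^ 2 ∂γ) = (α / (α - 1)) * ∫ s, s ∂γ ∧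
    (α < 2 → ∫⁻ s, ENNReal.ofReal (s ^ 3) ∂γ = ⊤) := by
  have hnonneg : ∀ᵐ s ∂γ, 0 ≤ s := hγ.ae_one_le.mono fun s hs => zero_le_one.trans hs
  have h1 := hγ.lintegral_lt_top hα
  have h2 := hγ.lintegral_sq hα
  refine ⟨?_, ?_, ?_, fun h => hγ.lintegral_cube_eq_top ⟨hα.1, h⟩⟩
  · exact (lintegral_ofReal_ne_top_iff_integrable (by fun_prop) hnonneg).1 h1.ne
  · refine (lintegral_ofReal_ne_top_iff_integrable (by fun_prop)
      (ae_of_all _ fun s => sq_nonneg s)).1 ?_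
    rw [h2]
    exact (ENNReal.mul_lt_top ENNReal.ofReal_lt_top h1).ne
  · have hc : 0 ≤ α / (α - 1) := div_nonneg (by linarith [hα.1]) (by linarith [hα.1])
    rw [integral_eq_lintegral_of_nonneg_ae (ae_of_all _ fun s => sq_nonneg s) (by fun_prop),
      integral_eq_lintegral_of_nonneg_ae hnonneg (by fun_prop), h2, ENNReal.toReal_mul,
      ENNReal.toReal_ofReal hc]
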